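/- arXiv:1912.11596 — 3 statements merged into one kernel-verified Lean document; each statement's English description precedes it below -/
import Mathlib

section
/- Fix a real Hilbert space V, an integer s ≥ 2 and real coefficients α_0, …, α_s with α_0 = α_1 = 1 and α_2 = 1/2. Assume the energy identity: there are an integer k* with 2 ≤ k* ≤ s, reals β_{k*}, …, β_s, and symmetric reals (γ_{i,j})_{0≤i,j≤s−1} such that for every semi-negative continuous linear operator Z on V and every u0 ∈ V, ‖R(Z)u0‖² − ‖u0‖² = Σ_{k=k*}^s β_k ‖Z^k u0‖² + Σ_{i,j=0}^{s−1} γ_{i,j} [Z^i u0, Z^j u0]. Suppose μ₀ ∈ ℝ is such that for every μ' > μ₀ the k*×k* matrix Γ* − diag(0, …, 0, μ') is negative definite, where Γ* := (γ_{i,j})_{0≤i,j≤k*−1}, and let μ > μ₀ and ν < −β_{k*}/2. Then the modified method with dispersive-diffusive superviscosity is strongly stable: there exists λ₀ > 0 such that for every semi-negative continuous linear operator Z on V with ‖Z‖ ≤ λ₀ and every u0 ∈ V, ‖u_M‖ ≤ ‖u0‖, where Z̃ := Z + μ(Z†)^{k*−1}Z^{k*} + ν(Z†)^{k*}Z^{k*}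 and u_M := R(Z̃) u0. -/
open RealInnerProductSpace ContinuousLinearMap

/-- The semi-inner-product `[v, w] := −⟨Zv, w⟩ − ⟨v, Zw⟩` associated with `Z`. -/
noncomputable def semiIP {V : Type*} [NormedAddCommGroup V] [InnerProductSpace ℝ V]
    (Z : V →L[ℝ] V) (v w : V) : ℝ :=
  -⟪Z v, w⟫ - ⟪v, Z w⟫

open scoped ContDiff

section SemiIP

variable {V : Type*} [NormedAddCommGroup V] [InnerProductSpace ℝ V]

theorem semiIP_comm (Z : V →L[ℝ] V) (v w : V) : semiIP Z v w = semiIP Z w v := by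
  simp only [semiIP, real_inner_comm (Z v), real_inner_comm v]
  ring

theorem semiIP_add_left (Z : V →L[ℝ] V) (v w x : V) :
    semiIP Z (v + w) x = semiIP Z v x + semiIP Z w x := by
  simp only [semiIP, map_add, inner_add_left]
  ring

theorem semiIP_add_right (Z : V →L[ℝ] V) (v w x : V) :
    semiIP Z v (w + x) = semiIP Z v w + semiIP Z v x := by
  simp only [semiIP, map_add, inner_add_right]
  ring

theorem semiIP_smul_left (Z : V →L[ℝ] V) (c : ℝ) (v w : V) :
    semiIP Z (c • v) w = c * semiIP Z v w := by
  simp only [semiIP, map_smul, real_inner_smul_left]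
  ring

theorem semiIP_smul_right (Z : V →L[ℝ] V) (c : ℝ) (v w : V) :
    semiIP Z v (c • w) = c * semiIP Z v w := by
  simp only [semiIP, map_smul, real_inner_smul_right]
  ring

theorem semiIP_zero_left (Z : V →L[ℝ] V) (w : V) : semiIP Z 0 w = 0 := by
  simp [semiIP]

theorem semiIP_zero_right (Z : V →L[ℝ] V) (v : V) : semiIP Z v 0 = 0 := by
  simp [semiIP]

theorem semiIP_sum_left {ι : Type*} (Z : V →L[ℝ] V) (t : Finset ι) (f : ι → V) (w : V) :
    semiIP Z (∑ i ∈ t, f i) w = ∑ i ∈ t, semiIP Z (f i) w := by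
  simp only [semiIP, map_sum, sum_inner, Finset.sum_sub_distrib, Finset.sum_neg_distrib]

theorem semiIP_sum_right {ι : Type*} (Z : V →L[ℝ] V) (t : Finset ι) (f : ι → V) (v : V) :
    semiIP Z v (∑ i ∈ t, f i) = ∑ i ∈ t, semiIP Z v (f i) := by
  simp only [semiIP, map_sum, inner_sum, Finset.sum_sub_distrib, Finset.sum_neg_distrib]

theorem semiIP_self_nonneg {Z : V →L[ℝ] V} (hZ : ∀ v : V, ⟪Z v, v⟫ ≤ 0) (v : V) :
    0 ≤ semiIP Z v v := by
  have := hZ v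
  rw [semiIP, real_inner_comm (Z v) v]
  linarith

theorem semiIP_self_le (Z : V →L[ℝ] V) (v : V) : semiIP Z v v ≤ 2 * ‖Z‖ * ‖v‖ ^ 2 := by
  have h1 : |⟪Z v, v⟫| ≤ ‖Z v‖ * ‖v‖ := abs_real_inner_le_norm _ _
  have h2 : ‖Z v‖ * ‖v‖ ≤ ‖Z‖ * ‖v‖ * ‖v‖ := by gcongr; exact Z.le_opNorm v
  have h3 := neg_abs_le ⟪Z v, v⟫
  rw [semiIP, real_inner_comm (Z v) v]
  linarith

/-- Cauchy–Schwarz for the semi-inner-product, in terms of bounds on the seminorms. -/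
theorem abs_semiIP_le {Z : V →L[ℝ] V} (hZ : ∀ v : V, ⟪Z v, v⟫ ≤ 0) {v w : V} {a b : ℝ}
    (ha : 0 ≤ a) (hb : 0 ≤ b) (hv : semiIP Z v v ≤ a ^ 2) (hw : semiIP Z w w ≤ b ^ 2) :
    |semiIP Z v w| ≤ a * b := by
  have hd := discrim_le_zero (a := semiIP Z w w) (b := 2 * semiIP Z v w) (c := semiIP Z v v)
    fun x => by
      have h := semiIP_self_nonneg hZ (v + x • w)
      simp only [semiIP_add_left, semiIP_add_right, semiIP_smul_left, semiIP_smul_right,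
        semiIP_comm Z w v] at h
      linarith
  rw [discrim] at hd
  have hm : semiIP Z w w * semiIP Z v v ≤ b ^ 2 * a ^ 2 :=
    mul_le_mul hw hv (semiIP_self_nonneg hZ v) (sq_nonneg b)
  refine abs_le_of_sq_le_sq ?_ (mul_nonneg ha hb)
  linarith

/-- A positive definite matrix stays uniformly coercive after its entries are paired with
semi-inner-products of vectors. -/
theorem Matrix.PosDef.exists_le_sum_mul_semiIP {n : Type*} [Fintype n] [DecidableEq n]
    {A : Matrix n n ℝ} (hA : A.PosDef) :
    ∃ ε : ℝ, 0 < ε ∧ ∀ Z : V →L[ℝ] V, (∀ v : V, ⟪Z v, v⟫ ≤ 0) → ∀ y : n → V,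
      ε * ∑ i, semiIP Z (y i) (y i) ≤ ∑ i, ∑ j, A i j * semiIP Z (y i) (y j) := by
  set e := hA.1.eigenvalues with he
  set U : Matrix n n ℝ := (hA.1.eigenvectorUnitary : Matrix n n ℝ) with hU
  obtain ⟨ε, hε, hle⟩ : ∃ ε : ℝ, 0 < ε ∧ ∀ l, ε ≤ e l := by
    rcases isEmpty_or_nonempty n with _ | _
    · exact ⟨1, one_pos, isEmptyElim⟩
    · obtain ⟨l, hl⟩ := Finite.exists_min e
      exact ⟨e l, hA.eigenvalues_pos l, hl⟩
  have hentry : ∀ i j, A i j = ∑ l, e l * (U i l * U j l) := by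
    intro i j
    have h := congrFun (congrFun hA.1.spectral_theorem i) j
    rw [Unitary.conjStarAlgAut_apply, Matrix.mul_apply] at h
    rw [h]
    refine Finset.sum_congr rfl fun l _ => ?_
    simp [Matrix.mul_diagonal, ← hU, ← he]
    ring
  have hone : ∀ i j, ∑ l, U i l * U j l = if i = j then 1 else 0 := by
    intro i j
    have h := congrFun (congrFun (Unitary.coe_mul_star_self hA.1.eigenvectorUnitary) i) j
    rwa [Matrix.mul_apply, Matrix.one_apply] at h
  refine ⟨ε, hε, fun Z hZ y => ?_⟩
  have key : ∀ d : n → ℝ, ∑ i, ∑ j, (∑ l, d l * (U i l * U j l)) * semiIP Z (y i) (y j)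
      = ∑ l, d l * semiIP Z (∑ i, U i l • y i) (∑ i, U i l • y i) := by
    intro d
    simp_rw [semiIP_sum_left, semiIP_smul_left, semiIP_sum_right, semiIP_smul_right,
      Finset.mul_sum, Finset.sum_mul]
    rw [eq_comm, Finset.sum_comm]
    refine Finset.sum_congr rfl fun i _ => ?_
    rw [Finset.sum_comm]
    exact Finset.sum_congr rfl fun j _ => Finset.sum_congr rfl fun l _ => by ring
  have h1 := key (fun _ => ε)
  have h2 := key e
  simp_rw [← hentry] at h2
  simp_rw [← Finset.mul_sum, hone] at h1
  rw [h2]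
  calc ε * ∑ i, semiIP Z (y i) (y i)
      = ε * ∑ l, semiIP Z (∑ i, U i l • y i) (∑ i, U i l • y i) := by
        rw [← h1, Finset.mul_sum]; simp
    _ ≤ _ := by
        rw [Finset.mul_sum]
        exact Finset.sum_le_sum fun l _ =>
          mul_le_mul_of_nonneg_right (hle l) (semiIP_self_nonneg hZ _)

/-- An energy identity valid for semi-negative operators is valid for all operators. -/
theorem energy_identity_of_semiNegative {s k : ℕ} {α β : ℕ → ℝ} {γ : ℕ → ℕ → ℝ}
    (h : ∀ Z : V →L[ℝ] V, (∀ v : V, ⟪Z v, v⟫ ≤ 0) → ∀ u : V,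
      ‖(∑ j ∈ Finset.range (s + 1), α j • Z ^ j) u‖ ^ 2 - ‖u‖ ^ 2
        = ∑ j ∈ Finset.Icc k s, β j * ‖(Z ^ j) u‖ ^ 2
          + ∑ i ∈ Finset.range s, ∑ j ∈ Finset.range s,
              γ i j * semiIP Z ((Z ^ i) u) ((Z ^ j) u))
    (Z : V →L[ℝ] V) (u : V) :
    ‖(∑ j ∈ Finset.range (s + 1), α j • Z ^ j) u‖ ^ 2 - ‖u‖ ^ 2
      = ∑ j ∈ Finset.Icc k s, β j * ‖(Z ^ j) u‖ ^ 2
        + ∑ i ∈ Finset.range s, ∑ j ∈ Finset.range s,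
            γ i j * semiIP Z ((Z ^ i) u) ((Z ^ j) u) := by
  let W : ℝ → V →L[ℝ] V := fun t => Z - t • (1 : V →L[ℝ] V)
  have hW : ContDiff ℝ ω W := by fun_prop
  have hWp : ∀ j : ℕ, ContDiff ℝ ω fun t => (W t ^ j) u := fun j => by fun_prop
  have hWW : ∀ j : ℕ, ContDiff ℝ ω fun t => W t ((W t ^ j) u) := fun j => by fun_prop
  have hl : ContDiff ℝ ω fun t =>
      ‖(∑ j ∈ Finset.range (s + 1), α j • W t ^ j) u‖ ^ 2 - ‖u‖ ^ 2 :=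
    (ContDiff.norm_sq ℝ (by fun_prop)).sub contDiff_const
  have hr : ContDiff ℝ ω fun t => ∑ j ∈ Finset.Icc k s, β j * ‖(W t ^ j) u‖ ^ 2
        + ∑ i ∈ Finset.range s, ∑ j ∈ Finset.range s,
            γ i j * semiIP (W t) ((W t ^ i) u) ((W t ^ j) u) :=
    (ContDiff.sum fun j _ => contDiff_const.mul ((hWp j).norm_sq ℝ)).add
      (ContDiff.sum fun i _ => ContDiff.sum fun j _ => contDiff_const.mul
        (((hWW i).inner ℝ (hWp j)).neg.sub ((hWp i).inner ℝ (hWW j))))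
  have heq := (contDiff_omega_iff_analyticOnNhd.1 hl).eq_of_eventuallyEq
    (contDiff_omega_iff_analyticOnNhd.1 hr) (z₀ := ‖Z‖ + 1) <| by
      filter_upwards [lt_mem_nhds (lt_add_one ‖Z‖)] with t ht
      refine h (W t) (fun v => ?_) u
      have h1 : ⟪Z v, v⟫ ≤ ‖Z v‖ * ‖v‖ := real_inner_le_norm _ _
      have h2 : ‖Z v‖ * ‖v‖ ≤ ‖Z‖ * ‖v‖ * ‖v‖ := by gcongr; exact Z.le_opNorm v
      have h3 : ‖Z‖ * ‖v‖ * ‖v‖ ≤ t * ‖v‖ * ‖v‖ := by gcongr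
      simp only [W, sub_apply, smul_apply, one_apply_eq_self, inner_sub_left, real_inner_smul_left,
        real_inner_self_eq_norm_mul_norm]
      linarith
  simpa [W] using congrFun heq 0

/-- Comparing first order terms in the energy identity determines `γ 0 0`. -/
theorem energy_identity_coeff_zero [Nontrivial V] {s k : ℕ} (hs : 1 ≤ s) (hk : 1 ≤ k)
    {α β : ℕ → ℝ} {γ : ℕ → ℕ → ℝ} (hα0 : α 0 = 1) (hα1 : α 1 = 1)
    (h : ∀ (Z : V →L[ℝ] V) (u : V),
      ‖(∑ j ∈ Finset.range (s + 1), α j • Z ^ j) u‖ ^ 2 - ‖u‖ ^ 2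
        = ∑ j ∈ Finset.Icc k s, β j * ‖(Z ^ j) u‖ ^ 2
          + ∑ i ∈ Finset.range s, ∑ j ∈ Finset.range s,
              γ i j * semiIP Z ((Z ^ i) u) ((Z ^ j) u)) :
    γ 0 0 = -1 := by
  obtain ⟨u, hu⟩ := exists_norm_eq V zero_le_one
  have hpoly : ∀ t : ℝ, (∑ j ∈ Finset.range (s + 1), α j * t ^ j) ^ 2 - 1
      = ∑ j ∈ Finset.Icc k s, β j * (t ^ j) ^ 2
        + ∑ i ∈ Finset.range s, ∑ j ∈ Finset.range s, γ i j * (t ^ i * t ^ j * (-2 * t)) := by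
    intro t
    have hp : ∀ j : ℕ, (t • (1 : V →L[ℝ] V)) ^ j = t ^ j • (1 : V →L[ℝ] V) := fun j => by
      rw [smul_pow, one_pow]
    have hs : ∀ i j : ℕ, semiIP (t • (1 : V →L[ℝ] V)) (t ^ i • u) (t ^ j • u)
        = t ^ i * t ^ j * (-2 * t) := fun i j => by
      simp only [semiIP_smul_left, semiIP_smul_right]
      simp only [semiIP, smul_apply, one_apply_eq_self, real_inner_smul_left, real_inner_smul_right,
        real_inner_self_eq_norm_sq, hu]
      ring
    have := h (t • 1) u
    simp only [hp, smul_smul, ← Finset.sum_smul, smul_apply, one_apply_eq_self, hs, norm_smul, hu,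
      Real.norm_eq_abs, mul_one, sq_abs, one_pow] at this
    exact this
  have hl : HasDerivAt (fun t : ℝ => (∑ j ∈ Finset.range (s + 1), α j * t ^ j) ^ 2 - 1) 2 0 := by
    have h1 := ((HasDerivAt.fun_sum fun (j : ℕ) (_ : j ∈ Finset.range (s + 1)) =>
      (hasDerivAt_pow j (0 : ℝ)).const_mul (α j)).fun_pow 2).sub_const 1
    refine h1.congr_deriv ?_
    have h2 : ∑ j ∈ Finset.range (s + 1), α j * (0 : ℝ) ^ j = 1 := by
      rw [Finset.sum_range_succ']; simp [hα0]
    have h3 : ∑ j ∈ Finset.range (s + 1), α j * (j * (0 : ℝ) ^ (j - 1)) = 1 := by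
      rw [Finset.sum_eq_single_of_mem 1 (by simp; omega)]
      · simp [hα1]
      · intro j _ hj
        rcases Nat.eq_zero_or_pos j with rfl | hj'
        · simp
        · simp [zero_pow (show j - 1 ≠ 0 by omega)]
    rw [h2, h3]
    norm_num
  have hr : HasDerivAt (fun t : ℝ => ∑ j ∈ Finset.Icc k s, β j * (t ^ j) ^ 2
      + ∑ i ∈ Finset.range s, ∑ j ∈ Finset.range s, γ i j * (t ^ i * t ^ j * (-2 * t)))
      (-2 * γ 0 0) 0 := by
    have h1 := (HasDerivAt.fun_sum fun (j : ℕ) (_ : j ∈ Finset.Icc k s) =>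
        ((hasDerivAt_pow j (0 : ℝ)).fun_pow 2).const_mul (β j)).fun_add
      (HasDerivAt.fun_sum fun (i : ℕ) (_ : i ∈ Finset.range s) =>
        HasDerivAt.fun_sum fun (j : ℕ) (_ : j ∈ Finset.range s) =>
          (((hasDerivAt_pow i (0 : ℝ)).fun_mul (hasDerivAt_pow j 0)).fun_mul
            ((hasDerivAt_id' (0 : ℝ)).const_mul (-2))).const_mul (γ i j))
    refine h1.congr_deriv ?_
    obtain ⟨s, rfl⟩ := Nat.exists_eq_add_of_le' hs
    rw [Finset.sum_eq_zero, Finset.sum_range_succ', Finset.sum_range_succ']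
    · simp
      ring
    · intro j hj
      have : j ≠ 0 := by have := (Finset.mem_Icc.1 hj).1; omega
      simp [this]
  have := hl.unique ((funext hpoly : _ = _) ▸ hr)
  linarith

end SemiIP

section Superviscosity

variable {V : Type*} [NormedAddCommGroup V] [InnerProductSpace ℝ V]

theorem norm_pow_apply_le_of_norm_le_one {Z : V →L[ℝ] V} (hZ : ‖Z‖ ≤ 1) (m : ℕ) (v : V) :
    ‖(Z ^ m) v‖ ≤ ‖v‖ := by
  induction m with
  | zero => simp
  | succ m ih =>
    rw [pow_succ', mul_apply_eq_comp]
    exact (Z.le_of_opNorm_le hZ _).trans (by rwa [one_mul])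

theorem norm_pow_apply_le_norm_mul {Z : V →L[ℝ] V} (hZ : ‖Z‖ ≤ 1) {m : ℕ} (hm : m ≠ 0) (v : V) :
    ‖(Z ^ m) v‖ ≤ ‖Z‖ * ‖v‖ := by
  obtain ⟨m, rfl⟩ := Nat.exists_eq_succ_of_ne_zero hm
  rw [Nat.succ_eq_add_one, pow_succ, mul_apply_eq_comp]
  exact (norm_pow_apply_le_of_norm_le_one hZ m _).trans (Z.le_opNorm v)

theorem semiIP_self_le_sq {Z : V →L[ℝ] V} {t r : ℝ} (hZ : ‖Z‖ ≤ t ^ 2) {v : V} (hv : ‖v‖ ≤ r) :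
    semiIP Z v v ≤ (2 * t * r) ^ 2 := by
  have h : 2 * ‖Z‖ * ‖v‖ ^ 2 ≤ 2 * t ^ 2 * r ^ 2 := by gcongr
  have := semiIP_self_le Z v
  nlinarith [mul_nonneg (sq_nonneg t) (sq_nonneg r)]

theorem abs_semiIP_sub_le {Z : V →L[ℝ] V} (hneg : ∀ v : V, ⟪Z v, v⟫ ≤ 0) {t q E : ℝ}
    (ht0 : 0 ≤ t) (ht1 : t ≤ 1) (hq : 0 ≤ q) (hE : 0 ≤ E) (hZ : ‖Z‖ ≤ t ^ 2) {x y v w : V}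
    (hv : semiIP Z v v ≤ q ^ 2) (hw : semiIP Z w w ≤ q ^ 2)
    (hx : ‖x - v‖ ≤ E * q) (hy : ‖y - w‖ ≤ E * q) :
    |semiIP Z x y - semiIP Z v w| ≤ 4 * E * (1 + E) * t * q ^ 2 := by
  have hp : 0 ≤ 2 * t * (E * q) := by positivity
  have h1 := abs_semiIP_le hneg hp hq (semiIP_self_le_sq hZ hx) hw
  have h2 := abs_semiIP_le hneg hq hp hv (semiIP_self_le_sq hZ hy)
  have h3 := abs_semiIP_le hneg hp hp (semiIP_self_le_sq hZ hx) (semiIP_self_le_sq hZ hy)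
  have h4 : semiIP Z x y - semiIP Z v w
      = semiIP Z (x - v) w + semiIP Z v (y - w) + semiIP Z (x - v) (y - w) := by
    conv_lhs => rw [← add_sub_cancel v x, ← add_sub_cancel w y]
    simp only [semiIP_add_left, semiIP_add_right]
    ring
  have h5 : t * (t * (E ^ 2 * q ^ 2)) ≤ t * (1 * (E ^ 2 * q ^ 2)) := by gcongr
  rw [h4]
  refine (abs_add_three _ _ _).trans ?_
  linarith

variable [CompleteSpace V]

/-- The operator modified with dispersive-diffusive superviscosity. -/
noncomputable def modifiedOp (k : ℕ) (μ ν : ℝ) (Z : V →L[ℝ] V) : V →L[ℝ] V :=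
  Z + μ • (adjoint Z ^ (k - 1) * Z ^ k) + ν • (adjoint Z ^ k * Z ^ k)

theorem adjoint_pow_eq (Z : V →L[ℝ] V) (m : ℕ) : adjoint Z ^ m = adjoint (Z ^ m) := by
  simp only [← star_eq_adjoint, star_pow]

theorem semiIP_modifiedOp {k : ℕ} (hk : 1 ≤ k) (μ ν : ℝ) (Z : V →L[ℝ] V) (v w : V) :
    semiIP (modifiedOp k μ ν Z) v w = semiIP Z v w
      + μ * semiIP Z ((Z ^ (k - 1)) v) ((Z ^ (k - 1)) w)
      - 2 * ν * ⟪(Z ^ k) v, (Z ^ k) w⟫ := by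
  have hZ : ∀ x, Z ((Z ^ (k - 1)) x) = (Z ^ k) x := fun x => by
    rw [← mul_apply_eq_comp, ← pow_succ', Nat.sub_add_cancel hk]
  simp only [modifiedOp, semiIP, adjoint_pow_eq, add_apply, smul_apply, mul_apply_eq_comp,
    inner_add_left, inner_add_right, real_inner_smul_left, real_inner_smul_right,
    adjoint_inner_left, adjoint_inner_right, hZ]
  ring

theorem norm_modifiedOp_sub_le {k : ℕ} (hk : 2 ≤ k) (μ ν : ℝ) {Z : V →L[ℝ] V} (hZ : ‖Z‖ ≤ 1)
    (v : V) : ‖modifiedOp k μ ν Z v - Z v‖ ≤ (|μ| + |ν|) * (‖Z‖ * ‖(Z ^ k) v‖) := by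
  have hadj : ‖adjoint Z‖ = ‖Z‖ := LinearIsometryEquiv.norm_map _ _
  have hb : ∀ m : ℕ, m ≠ 0 → ∀ x, ‖(adjoint Z ^ m) x‖ ≤ ‖Z‖ * ‖x‖ := fun m hm x => by
    simpa only [hadj] using norm_pow_apply_le_norm_mul (hadj.le.trans hZ) hm x
  have h : modifiedOp k μ ν Z v - Z v = μ • (adjoint Z ^ (k - 1)) ((Z ^ k) v)
      + ν • (adjoint Z ^ k) ((Z ^ k) v) := by
    simp only [modifiedOp, add_apply, smul_apply, mul_apply_eq_comp]
    abel
  rw [h, add_mul]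
  refine (norm_add_le _ _).trans ?_
  rw [norm_smul, norm_smul, Real.norm_eq_abs, Real.norm_eq_abs]
  gcongr
  · exact hb _ (by omega) _
  · exact hb _ (by omega) _

theorem norm_modifiedOp_pow_sub_le {k : ℕ} (hk : 2 ≤ k) (μ ν : ℝ) {Z : V →L[ℝ] V}
    (hZ : ‖Z‖ ≤ 1) (u : V) (i : ℕ) :
    ‖(modifiedOp k μ ν Z ^ i) u - (Z ^ i) u‖
      ≤ ((1 + (|μ| + |ν|)) ^ i - 1) * (‖Z‖ * ‖(Z ^ k) u‖) := by
  set c := |μ| + |ν| with hc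
  have hc0 : 0 ≤ c := by positivity
  set N := ‖(Z ^ k) u‖ with hN
  induction i with
  | zero => simp
  | succ i ih =>
    set x := (modifiedOp k μ ν Z ^ i) u with hx
    set b := (1 + c) ^ i - 1 with hb
    have hb0 : 0 ≤ b := sub_nonneg.2 (one_le_pow₀ (by linarith))
    have hbN : b * (‖Z‖ * N) ≤ b * N := by
      gcongr
      exact mul_le_of_le_one_left (norm_nonneg _) hZ
    have h1 : ‖(Z ^ k) x‖ ≤ N + b * N := by
      have h2 : (Z ^ k) x = (Z ^ i) ((Z ^ k) u) + (Z ^ k) (x - (Z ^ i) u) := by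
        have h4 : (Z ^ i) ((Z ^ k) u) = (Z ^ k) ((Z ^ i) u) := by
          rw [← mul_apply_eq_comp, ← mul_apply_eq_comp, ← pow_add, ← pow_add, add_comm]
        rw [map_sub, h4]
        abel
      rw [h2]
      exact (norm_add_le _ _).trans (add_le_add (norm_pow_apply_le_of_norm_le_one hZ _ _)
        ((norm_pow_apply_le_of_norm_le_one hZ _ _).trans (ih.trans hbN)))
    have h3 : (modifiedOp k μ ν Z ^ (i + 1)) u - (Z ^ (i + 1)) u
        = (modifiedOp k μ ν Z x - Z x) + Z (x - (Z ^ i) u) := by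
      rw [pow_succ', pow_succ', mul_apply_eq_comp, mul_apply_eq_comp, map_sub]
      abel
    rw [h3]
    calc _ ≤ c * (‖Z‖ * ‖(Z ^ k) x‖) + ‖Z‖ * ‖x - (Z ^ i) u‖ :=
          (norm_add_le _ _).trans (add_le_add (norm_modifiedOp_sub_le hk μ ν hZ x) (Z.le_opNorm _))
      _ ≤ c * (‖Z‖ * (N + b * N)) + ‖Z‖ * (b * N) := by
          gcongr
          exact ih.trans hbN
      _ = _ := by
          rw [pow_succ, show (1 + c) ^ i = b + 1 by rw [hb]; ring]
          ring

section PowerBounds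

variable {k : ℕ} {μ ν E : ℝ} {s : ℕ} {Z : V →L[ℝ] V}

theorem norm_modifiedOp_pow_sub_le_of_le (hk : 2 ≤ k) (hE : (1 + (|μ| + |ν|)) ^ s ≤ E)
    (hZ : ‖Z‖ ≤ 1) (u : V) {i : ℕ} (hi : i ≤ s) :
    ‖(modifiedOp k μ ν Z ^ i) u - (Z ^ i) u‖ ≤ (E - 1) * (‖Z‖ * ‖(Z ^ k) u‖) := by
  refine (norm_modifiedOp_pow_sub_le hk μ ν hZ u i).trans ?_
  gcongr
  refine le_trans ?_ hE
  gcongr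
  linarith [abs_nonneg μ, abs_nonneg ν]

theorem norm_pow_modifiedOp_pow_le_add (hk : 2 ≤ k) (hE : (1 + (|μ| + |ν|)) ^ s ≤ E)
    (hZ : ‖Z‖ ≤ 1) (u : V) {i m : ℕ} (hi : i ≤ s) :
    ‖(Z ^ m) ((modifiedOp k μ ν Z ^ i) u)‖
      ≤ ‖(Z ^ (m + i)) u‖ + (E - 1) * (‖Z‖ * ‖(Z ^ k) u‖) := by
  have h : (Z ^ m) ((modifiedOp k μ ν Z ^ i) u) = (Z ^ (m + i)) u
      + (Z ^ m) ((modifiedOp k μ ν Z ^ i) u - (Z ^ i) u) := by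
    rw [pow_add, mul_apply_eq_comp, map_sub]
    abel
  rw [h]
  exact (norm_add_le _ _).trans (add_le_add_right
    ((norm_pow_apply_le_of_norm_le_one hZ _ _).trans
      (norm_modifiedOp_pow_sub_le_of_le hk hE hZ u hi)) _)

theorem norm_pow_modifiedOp_pow_le_mul_of_lt (hk : 2 ≤ k) (hE : (1 + (|μ| + |ν|)) ^ s ≤ E)
    (hZ : ‖Z‖ ≤ 1) (u : V) {i m : ℕ} (hi : i ≤ s) (hm : k < m + i) :
    ‖(Z ^ m) ((modifiedOp k μ ν Z ^ i) u)‖ ≤ E * (‖Z‖ * ‖(Z ^ k) u‖) := by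
  have h : ‖(Z ^ (m + i)) u‖ ≤ ‖Z‖ * ‖(Z ^ k) u‖ := by
    rw [show m + i = (m + i - k) + k by omega, pow_add, mul_apply_eq_comp]
    exact norm_pow_apply_le_norm_mul hZ (by omega) _
  linarith [norm_pow_modifiedOp_pow_le_add (m := m) hk hE hZ u hi]

theorem norm_pow_modifiedOp_pow_le (hk : 2 ≤ k) (hE : (1 + (|μ| + |ν|)) ^ s ≤ E)
    (hZ : ‖Z‖ ≤ 1) (u : V) {i m : ℕ} (hi : i ≤ s) (hm : k ≤ m + i) :
    ‖(Z ^ m) ((modifiedOp k μ ν Z ^ i) u)‖ ≤ E * ‖(Z ^ k) u‖ := by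
  have h : ‖(Z ^ (m + i)) u‖ ≤ ‖(Z ^ k) u‖ := by
    rw [show m + i = (m + i - k) + k by omega, pow_add, mul_apply_eq_comp]
    exact norm_pow_apply_le_of_norm_le_one hZ _ _
  have h1 : 0 ≤ E - 1 := sub_nonneg.2 <|
    (one_le_pow₀ (by linarith [abs_nonneg μ, abs_nonneg ν])).trans hE
  have h2 : (E - 1) * (‖Z‖ * ‖(Z ^ k) u‖) ≤ (E - 1) * (1 * ‖(Z ^ k) u‖) := by gcongr
  linarith [norm_pow_modifiedOp_pow_le_add (m := m) hk hE hZ u hi]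

theorem abs_norm_modifiedOp_pow_sq_sub_le (hk : 2 ≤ k) (hE : (1 + (|μ| + |ν|)) ^ s ≤ E)
    (hE1 : 1 ≤ E) {t q : ℝ} (ht0 : 0 ≤ t) (ht1 : t ≤ 1) (hZ : ‖Z‖ ≤ t ^ 2) (u : V)
    (hN : ‖(Z ^ k) u‖ ≤ q) {i : ℕ} (hi : i ≤ s) (hki : k ≤ i) :
    |‖(modifiedOp k μ ν Z ^ i) u‖ ^ 2 - if i = k then ‖(Z ^ k) u‖ ^ 2 else 0|
      ≤ 2 * E ^ 2 * t * q ^ 2 := by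
  have htt : t ^ 2 ≤ t := by nlinarith
  have hZ1 : ‖Z‖ ≤ 1 := by linarith
  have hq : 0 ≤ q := (norm_nonneg _).trans hN
  have hx : ‖(modifiedOp k μ ν Z ^ i) u‖ ≤ E * q := by
    have := norm_pow_modifiedOp_pow_le (m := 0) hk hE hZ1 u hi (by omega)
    rw [pow_zero, one_apply_eq_self] at this
    exact this.trans (by gcongr)
  have hZN : ‖Z‖ * ‖(Z ^ k) u‖ ≤ t * q := by
    gcongr
    exact hZ.trans htt
  set x := (modifiedOp k μ ν Z ^ i) u
  split_ifs with hik
  · subst hik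
    have hd : ‖x - (Z ^ i) u‖ ≤ E * (t * q) := by
      refine (norm_modifiedOp_pow_sub_le_of_le hk hE hZ1 u hi).trans ?_
      gcongr
      linarith
    have h1 := abs_norm_sub_norm_le x ((Z ^ i) u)
    have hs : ‖x‖ + ‖(Z ^ i) u‖ ≤ 2 * (E * q) := by nlinarith
    rw [sq_sub_sq, abs_mul, abs_of_nonneg (by positivity : 0 ≤ ‖x‖ + ‖(Z ^ i) u‖)]
    calc _ ≤ 2 * (E * q) * (E * (t * q)) := by
          gcongr
          exact h1.trans hd
      _ = _ := by ring
  · have hx' : ‖x‖ ≤ E * (t * q) := by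
      have := norm_pow_modifiedOp_pow_le_mul_of_lt (m := 0) hk hE hZ1 u hi (by omega)
      rw [pow_zero, one_apply_eq_self] at this
      exact this.trans (by gcongr)
    rw [sub_zero, abs_of_nonneg (sq_nonneg _), sq]
    have h1 : ‖x‖ * ‖x‖ ≤ (E * q) * (E * (t * q)) := by gcongr
    have h2 : 0 ≤ E * q * (E * (t * q)) := by positivity
    linarith

theorem abs_semiIP_modifiedOp_pow_sub_le (hk : 2 ≤ k) (hE : (1 + (|μ| + |ν|)) ^ s ≤ E)
    (hE1 : 1 ≤ E) {t q : ℝ} (ht0 : 0 ≤ t) (ht1 : t ≤ 1)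
    (hneg : ∀ v : V, ⟪Z v, v⟫ ≤ 0) (hZ : ‖Z‖ ≤ t ^ 2) (u : V)
    (hN : ‖(Z ^ k) u‖ ≤ q) (hS : ∀ i < k, semiIP Z ((Z ^ i) u) ((Z ^ i) u) ≤ q ^ 2)
    {i j : ℕ} (hi : i ≤ s) (hj : j ≤ s) :
    |semiIP (modifiedOp k μ ν Z) ((modifiedOp k μ ν Z ^ i) u) ((modifiedOp k μ ν Z ^ j) u)
      - (semiIP Z (if i < k then (Z ^ i) u else 0) (if j < k then (Z ^ j) u else 0)
        + if i = 0 ∧ j = 0 then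
            μ * semiIP Z ((Z ^ (k - 1)) u) ((Z ^ (k - 1)) u) - 2 * ν * ‖(Z ^ k) u‖ ^ 2
          else 0)|
      ≤ (4 * E * (1 + E) + |μ| * (4 * E ^ 2) + 2 * |ν| * E ^ 2) * t * q ^ 2 := by
  have htt : t ^ 2 ≤ t := by nlinarith
  have hZ1 : ‖Z‖ ≤ 1 := by linarith
  have hq : 0 ≤ q := (norm_nonneg _).trans hN
  have hEN : E * ‖(Z ^ k) u‖ ≤ E * q := by gcongr
  have hZN : E * (‖Z‖ * ‖(Z ^ k) u‖) ≤ E * (t * q) := by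
    gcongr
    exact hZ.trans htt
  rw [semiIP_modifiedOp (by omega)]
  let x : ℕ → V := fun i => (modifiedOp k μ ν Z ^ i) u
  let y : ℕ → V := fun i => if i < k then (Z ^ i) u else 0
  have hy : ∀ i, semiIP Z (y i) (y i) ≤ q ^ 2 := by
    intro i
    by_cases h : i < k
    · simpa only [y, if_pos h] using hS i h
    · simpa only [y, if_neg h, semiIP_zero_left] using sq_nonneg q
  have hxy : ∀ i ≤ s, ‖x i - y i‖ ≤ E * q := by
    intro i hi
    by_cases h : i < k
    · simp only [x, y, if_pos h]
      refine (norm_modifiedOp_pow_sub_le_of_le hk hE hZ1 u hi).trans ?_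
      gcongr
      · linarith
      · linarith [mul_le_of_le_one_left (norm_nonneg ((Z ^ k) u)) hZ1]
    · simp only [x, y, if_neg h, sub_zero]
      have := norm_pow_modifiedOp_pow_le (m := 0) hk hE hZ1 u hi (by omega)
      rw [pow_zero, one_apply_eq_self] at this
      exact this.trans hEN
  have hmain := abs_semiIP_sub_le hneg ht0 ht1 hq (by linarith) hZ (hy i) (hy j)
    (hxy i hi) (hxy j hj)
  have hsmall : ∀ i ≤ s, i ≠ 0 →
      semiIP Z ((Z ^ (k - 1)) (x i)) ((Z ^ (k - 1)) (x i)) ≤ (2 * t * (E * q)) ^ 2 :=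
    fun i hi h0 => semiIP_self_le_sq hZ
      ((norm_pow_modifiedOp_pow_le hk hE hZ1 u hi (by omega)).trans hEN)
  have hlarge : ∀ i ≤ s,
      semiIP Z ((Z ^ (k - 1)) (x i)) ((Z ^ (k - 1)) (x i)) ≤ (2 * (E * q)) ^ 2 := by
    intro i hi
    rcases eq_or_ne i 0 with rfl | h0
    · simp only [x, pow_zero, one_apply_eq_self]
      refine (hS (k - 1) (by omega)).trans ?_
      gcongr
      nlinarith
    · refine (hsmall i hi h0).trans ?_
      gcongr
      linarith
  have hcross : ∀ i ≤ s, ∀ j ≤ s, i ≠ 0 →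
      |semiIP Z ((Z ^ (k - 1)) (x i)) ((Z ^ (k - 1)) (x j))| ≤ 4 * E ^ 2 * (t * q ^ 2) := by
    intro i hi j hj h0
    refine (abs_semiIP_le hneg (by positivity) (by positivity) (hsmall i hi h0)
      (hlarge j hj)).trans_eq ?_
    ring
  have hz : ∀ i ≤ s, ‖(Z ^ k) (x i)‖ ≤ E * q := fun i hi =>
    (norm_pow_modifiedOp_pow_le hk hE hZ1 u hi (by omega)).trans hEN
  have hinner : ∀ i ≤ s, ∀ j ≤ s, i ≠ 0 →
      |⟪(Z ^ k) (x i), (Z ^ k) (x j)⟫| ≤ E ^ 2 * (t * q ^ 2) := by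
    intro i hi j hj h0
    refine (abs_real_inner_le_norm _ _).trans ?_
    have h1 : ‖(Z ^ k) (x i)‖ ≤ E * (t * q) :=
      (norm_pow_modifiedOp_pow_le_mul_of_lt hk hE hZ1 u hi (by omega)).trans hZN
    calc _ ≤ E * (t * q) * (E * q) := by
          gcongr
          exact hz j hj
      _ = _ := by ring
  have htq : 0 ≤ t * q ^ 2 := by positivity
  by_cases h0 : i = 0 ∧ j = 0
  · obtain ⟨rfl, rfl⟩ := h0
    have hk0 : 0 < k := by omega
    have hC : 0 ≤ 4 * E * (1 + E) + |μ| * (4 * E ^ 2) + 2 * |ν| * E ^ 2 := by positivity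
    simp only [pow_zero, one_apply_eq_self, hk0, if_true, and_self, real_inner_self_eq_norm_sq]
    rw [show ∀ a b c : ℝ, a + b - c - (a + (b - c)) = 0 by intros; ring, abs_zero, mul_assoc]
    exact mul_nonneg hC htq
  · rw [if_neg h0, add_zero]
    obtain ⟨h1, h2⟩ : |semiIP Z ((Z ^ (k - 1)) (x i)) ((Z ^ (k - 1)) (x j))|
        ≤ 4 * E ^ 2 * (t * q ^ 2) ∧
        |⟪(Z ^ k) (x i), (Z ^ k) (x j)⟫| ≤ E ^ 2 * (t * q ^ 2) := by
      by_cases hi0 : i = 0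
      · have hj0 : j ≠ 0 := fun h => h0 ⟨hi0, h⟩
        rw [semiIP_comm, real_inner_comm]
        exact ⟨hcross j hj i hi hj0, hinner j hj i hi hj0⟩
      · exact ⟨hcross i hi j hj hi0, hinner i hi j hj hi0⟩
    have h3 := mul_le_mul_of_nonneg_left h1 (abs_nonneg μ)
    have h4 := mul_le_mul_of_nonneg_left h2 (abs_nonneg (2 * ν))
    rw [← abs_mul] at h3 h4
    rw [abs_mul 2 ν, abs_two] at h4
    change |semiIP Z (x i) (x j) + μ * semiIP Z ((Z ^ (k - 1)) (x i)) ((Z ^ (k - 1)) (x j))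
      - 2 * ν * ⟪(Z ^ k) (x i), (Z ^ k) (x j)⟫ - semiIP Z (y i) (y j)| ≤ _
    rw [show ∀ a b c d : ℝ, a + b - c - d = (a - d) + b + -c by intros; ring]
    refine (abs_add_three _ _ _).trans ?_
    rw [abs_neg]
    linarith

end PowerBounds

end Superviscosity

theorem Finset.sum_mul_le_of_abs_sub_le {ι : Type*} {t : Finset ι} {a f g : ι → ℝ} {δ : ℝ}
    (h : ∀ i ∈ t, |f i - g i| ≤ δ) :
    ∑ i ∈ t, a i * f i ≤ ∑ i ∈ t, a i * g i + (∑ i ∈ t, |a i|) * δ := by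
  rw [Finset.sum_mul, ← Finset.sum_add_distrib]
  refine Finset.sum_le_sum fun i hi => ?_
  have h1 := mul_le_mul_of_nonneg_left (h i hi) (abs_nonneg (a i))
  rw [← abs_mul] at h1
  linarith [le_abs_self (a i * (f i - g i))]

/-- strong stability of the modified method with dispersive-diffusive
superviscosity `μ > μ₀`, `ν < −β_{k*}/2`. -/
theorem modified_dispersive_diffusive_strongly_stable
    {V : Type*} [NormedAddCommGroup V] [InnerProductSpace ℝ V] [CompleteSpace V]
    (s : ℕ) (hs : 2 ≤ s) (α : ℕ → ℝ) (hα0 : α 0 = 1) (hα1 : α 1 = 1) (hα2 : α 2 = 1 / 2)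
    (kst : ℕ) (hk1 : 2 ≤ kst) (hks : kst ≤ s)
    (β : ℕ → ℝ) (γ : ℕ → ℕ → ℝ) (hsym : ∀ i j, γ i j = γ j i)
    (hidentity : ∀ Z : V →L[ℝ] V, (∀ v : V, ⟪Z v, v⟫ ≤ 0) → ∀ u0 : V,
      ‖(∑ j ∈ Finset.range (s + 1), α j • Z ^ j) u0‖ ^ 2 - ‖u0‖ ^ 2
        = ∑ k ∈ Finset.Icc kst s, β k * ‖(Z ^ k) u0‖ ^ 2
          + ∑ i ∈ Finset.range s, ∑ j ∈ Finset.range s,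
              γ i j * semiIP Z ((Z ^ i) u0) ((Z ^ j) u0))
    (μ₀ : ℝ)
    (hmat : ∀ μ' : ℝ, μ₀ < μ' →
      (-(Matrix.of (fun i j : Fin kst => γ i j)
          - Matrix.diagonal (fun i : Fin kst => if (i : ℕ) = kst - 1 then μ' else 0))).PosDef)
    (μ ν : ℝ) (hμ : μ₀ < μ) (hν : ν < -β kst / 2) :
    ∃ lam0 : ℝ, 0 < lam0 ∧
      ∀ Z : V →L[ℝ] V, (∀ v : V, ⟪Z v, v⟫ ≤ 0) → ‖Z‖ ≤ lam0 → ∀ u0 : V,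
        ‖(∑ j ∈ Finset.range (s + 1),
            α j • (Z + μ • (adjoint Z ^ (kst - 1) * Z ^ kst)
              + ν • (adjoint Z ^ kst * Z ^ kst)) ^ j) u0‖ ≤ ‖u0‖ := by
  rcases subsingleton_or_nontrivial V with _ | _
  · exact ⟨1, one_pos, fun Z _ _ u => by simp [Subsingleton.elim _ (0 : V)]⟩
  have hid := energy_identity_of_semiNegative hidentity
  have hγ : γ 0 0 = -1 := energy_identity_coeff_zero (by omega) (by omega) hα0 hα1 hid
  obtain ⟨ε, hε, hcoer⟩ := (hmat μ hμ).exists_le_sum_mul_semiIP (V := V)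
  set E := (1 + (|μ| + |ν|)) ^ s with hE
  have hE1 : 1 ≤ E := one_le_pow₀ (by linarith [abs_nonneg μ, abs_nonneg ν])
  set K := (∑ j ∈ Finset.Icc kst s, |β j|) * (2 * E ^ 2)
    + (∑ p ∈ Finset.range s ×ˢ Finset.range s, |γ p.1 p.2|)
      * (4 * E * (1 + E) + |μ| * (4 * E ^ 2) + 2 * |ν| * E ^ 2) with hK
  have hK0 : 0 ≤ K := by positivity
  obtain ⟨δ, hδ, hδε, hδβ⟩ : ∃ δ : ℝ, 0 < δ ∧ δ ≤ ε ∧ δ ≤ -(β kst + 2 * ν) :=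
    ⟨min ε (-(β kst + 2 * ν)), lt_min hε (by linarith), min_le_left _ _, min_le_right _ _⟩
  obtain ⟨t, ht, ht1, htK⟩ : ∃ t : ℝ, 0 < t ∧ t ≤ 1 ∧ K * t ≤ δ := by
    refine ⟨min 1 (δ / (K + 1)), lt_min one_pos (by positivity), min_le_left _ _, ?_⟩
    calc K * min 1 (δ / (K + 1)) ≤ (K + 1) * (δ / (K + 1)) := by
          gcongr
          · linarith
          · exact min_le_right _ _
      _ = δ := by field_simp
  refine ⟨t ^ 2, by positivity, fun Z hneg hZ u => ?_⟩
  change ‖(∑ j ∈ Finset.range (s + 1), α j • modifiedOp kst μ ν Z ^ j) u‖ ≤ ‖u‖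
  refine le_of_sq_le_sq ?_ (norm_nonneg u)
  rw [← sub_nonpos, hid]
  let y : ℕ → V := fun i => (Z ^ i) u
  have hS0 : ∀ i, 0 ≤ semiIP Z (y i) (y i) := fun i => semiIP_self_nonneg hneg _
  set S := ∑ i ∈ Finset.range kst, semiIP Z (y i) (y i) with hS
  have hSnn : 0 ≤ S := Finset.sum_nonneg fun i _ => hS0 i
  set q := √(‖y kst‖ ^ 2 + S) with hq
  have hq2 : q ^ 2 = ‖y kst‖ ^ 2 + S := Real.sq_sqrt (by positivity)
  have hN : ‖y kst‖ ≤ q := Real.le_sqrt_of_sq_le (by linarith)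
  have hSq : ∀ i < kst, semiIP Z (y i) (y i) ≤ q ^ 2 := fun i hi => by
    have := Finset.single_le_sum (fun i _ => hS0 i) (Finset.mem_range.2 hi)
    nlinarith [sq_nonneg ‖y kst‖]
  have hβsum := Finset.sum_mul_le_of_abs_sub_le (a := β) fun j (hj : j ∈ Finset.Icc kst s) =>
    abs_norm_modifiedOp_pow_sq_sub_le (μ := μ) (ν := ν) hk1 hE.ge hE1 ht.le ht1 hZ u hN
      (Finset.mem_Icc.1 hj).2 (Finset.mem_Icc.1 hj).1
  have hγsum := Finset.sum_mul_le_of_abs_sub_le (a := fun p : ℕ × ℕ => γ p.1 p.2)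
    fun p (hp : p ∈ Finset.range s ×ˢ Finset.range s) =>
      abs_semiIP_modifiedOp_pow_sub_le (μ := μ) (ν := ν) hk1 hE.ge hE1 ht.le ht1 hneg hZ u hN hSq
        (Finset.mem_range.1 (Finset.mem_product.1 hp).1).le
        (Finset.mem_range.1 (Finset.mem_product.1 hp).2).le
  have hβmain : ∑ j ∈ Finset.Icc kst s, β j * (if j = kst then ‖(Z ^ kst) u‖ ^ 2 else 0)
      = β kst * ‖y kst‖ ^ 2 := by
    rw [Finset.sum_eq_single_of_mem kst (Finset.mem_Icc.2 ⟨le_rfl, hks⟩)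
      fun j _ hj => by rw [if_neg hj, mul_zero], if_pos rfl]
  have hγmain : ∀ c : ℝ, ∑ p ∈ Finset.range s ×ˢ Finset.range s, γ p.1 p.2 *
      (semiIP Z (if p.1 < kst then (Z ^ p.1) u else 0) (if p.2 < kst then (Z ^ p.2) u else 0)
        + if p.1 = 0 ∧ p.2 = 0 then c else 0)
      = ∑ i ∈ Finset.range kst, ∑ j ∈ Finset.range kst, γ i j * semiIP Z (y i) (y j) - c := by
    intro c
    simp only [mul_add, Finset.sum_add_distrib]
    rw [sub_eq_add_neg]
    congr 1
    · rw [← Finset.sum_product', ← Finset.sum_subset (Finset.product_subset_product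
        (Finset.range_subset_range.2 hks) (Finset.range_subset_range.2 hks))]
      · refine Finset.sum_congr rfl fun p hp => ?_
        obtain ⟨h1, h2⟩ := Finset.mem_product.1 hp
        rw [if_pos (Finset.mem_range.1 h1), if_pos (Finset.mem_range.1 h2)]
      · intro p _ hp
        rw [Finset.mem_product, Finset.mem_range, Finset.mem_range, not_and_or] at hp
        rcases hp with hp | hp
        · rw [if_neg hp, semiIP_zero_left, mul_zero]
        · rw [if_neg hp, semiIP_zero_right, mul_zero]
    · rw [Finset.sum_eq_single_of_mem (0, 0) (by simp; omega)]
      · simp [hγ]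
      · intro p _ hp
        rw [if_neg fun h => hp (Prod.ext h.1 h.2), mul_zero]
  have hquad : ε * S ≤ μ * semiIP Z (y (kst - 1)) (y (kst - 1))
      - ∑ i ∈ Finset.range kst, ∑ j ∈ Finset.range kst, γ i j * semiIP Z (y i) (y j) := by
    have h := hcoer Z hneg fun i : Fin kst => y i
    rw [Fin.sum_univ_eq_sum_range fun i => semiIP Z (y i) (y i)] at h
    refine h.trans_eq ?_
    have hlast : ∑ i : Fin kst, (if (i : ℕ) = kst - 1 then μ else 0) * semiIP Z (y i) (y i)
        = μ * semiIP Z (y (kst - 1)) (y (kst - 1)) := by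
      rw [Finset.sum_eq_single_of_mem (⟨kst - 1, by omega⟩ : Fin kst) (Finset.mem_univ _)
        fun i _ hi => by rw [if_neg fun h => hi (Fin.ext h), zero_mul], if_pos rfl]
    simp only [← hlast, Finset.sum_range, ← Finset.sum_sub_distrib]
    refine Finset.sum_congr rfl fun i _ => ?_
    simp only [Matrix.neg_apply, Matrix.sub_apply, Matrix.of_apply, Matrix.diagonal_apply,
      neg_sub, sub_mul, Finset.sum_sub_distrib, ite_mul, zero_mul, Finset.sum_ite_eq,
      Finset.mem_univ, if_true]
  rw [Finset.sum_product' (f := fun i j => γ i j * semiIP (modifiedOp kst μ ν Z)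
    ((modifiedOp kst μ ν Z ^ i) u) ((modifiedOp kst μ ν Z ^ j) u)), hγmain] at hγsum
  rw [hβmain] at hβsum
  have hKt : K * t * q ^ 2 ≤ δ * q ^ 2 := by gcongr
  have hδS : δ * S ≤ ε * S := by gcongr
  have hδN : δ * ‖y kst‖ ^ 2 ≤ -(β kst + 2 * ν) * ‖y kst‖ ^ 2 := by gcongr
  rw [hK] at hKt
  have hq3 : δ * q ^ 2 = δ * ‖y kst‖ ^ 2 + δ * S := by rw [hq2]; ring
  refine (add_le_add hβsum hγsum).trans ?_
  linarith
end

section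
/- Fix a real Hilbert space V, an integer s ≥ 1 and real coefficients α_0, …, α_s with α_0 = α_1 = 1. Assume the energy identity: there are an integer k* with 1 ≤ k* ≤ s, reals β_{k*}, …, β_s, and symmetric reals (γ_{i,j})_{0≤i,j≤s−1} such that for every semi-negative continuous linear operator Z on V and every u0 ∈ V, ‖R(Z)u0‖² − ‖u0‖² = Σ_{k=k*}^s β_k ‖Z^k u0‖² + Σ_{i,j=0}^{s−1} γ_{i,j} [Z^i u0, Z^j u0]. Let μ, ν ∈ ℝ with ν > −β_{k*}/2, and with μ = 0 in case k* = 1. Then the filtering method is not strongly stable: there exists λ₀ > 0 such that for every continuous linear operator Z on V satisfying ⟨Zv, v⟩ = 0 for all v ∈ V and ‖Z‖ ≤ λ₀, and every u0 ∈ V with Z^{k*} u0 ≠ 0, one has ‖u_F‖ > ‖u0‖, where u_F := (I + μ(Z†)^{k*−1}Z^{k*} + ν(Z†)^{k*}Z^{k*}) R(Z) u0. -/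
open RealInnerProductSpace ContinuousLinearMap

section Conservative

variable {V : Type*} [NormedAddCommGroup V] [InnerProductSpace ℝ V]

theorem semiIP_eq_zero_of_conservative {Z : V →L[ℝ] V} (hZ : ∀ v : V, ⟪Z v, v⟫ = 0) (v w : V) :
    semiIP Z v w = 0 := by
  have h := hZ (v + w)
  rw [map_add, inner_add_left, inner_add_right, inner_add_right, hZ v, hZ w,
    real_inner_comm v (Z w)] at h
  unfold semiIP
  linarith

theorem norm_pow_apply_sq_le {Z : V →L[ℝ] V} {c : ℝ} (hZ : ‖Z‖ ≤ c) (hc : c ≤ 1)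
    {m : ℕ} (hm : 1 ≤ m) (y : V) : ‖(Z ^ m) y‖ ^ 2 ≤ c * ‖y‖ ^ 2 := by
  have hc0 : 0 ≤ c := (norm_nonneg Z).trans hZ
  have hpow : ‖Z ^ m‖ ≤ c :=
    (norm_pow_le' Z hm).trans <| (pow_le_pow_left₀ (norm_nonneg Z) hZ m).trans <|
      pow_le_of_le_one hc0 hc (by lia)
  have h : ‖(Z ^ m) y‖ ≤ c * ‖y‖ := (Z ^ m).le_of_opNorm_le hpow y
  calc ‖(Z ^ m) y‖ ^ 2 ≤ (c * ‖y‖) ^ 2 := by gcongr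
    _ = c ^ 2 * ‖y‖ ^ 2 := by ring
    _ ≤ c * ‖y‖ ^ 2 := by
      gcongr
      nlinarith

theorem abs_sum_mul_norm_pow_apply_sq_le {Z : V →L[ℝ] V} {c : ℝ} (hZ : ‖Z‖ ≤ c) (hc : c ≤ 1)
    (S : Finset ℕ) (b : ℕ → ℝ) (e : ℕ → ℕ) (he : ∀ j ∈ S, 1 ≤ e j) (y : V) :
    |∑ j ∈ S, b j * ‖(Z ^ e j) y‖ ^ 2| ≤ (∑ j ∈ S, |b j|) * (c * ‖y‖ ^ 2) := by
  rw [Finset.sum_mul]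
  refine (Finset.abs_sum_le_sum_abs _ _).trans (Finset.sum_le_sum fun j hj => ?_)
  rw [abs_mul, abs_of_nonneg (sq_nonneg ‖(Z ^ e j) y‖)]
  exact mul_le_mul_of_nonneg_left (norm_pow_apply_sq_le hZ hc (he j hj) y) (abs_nonneg _)

theorem inner_adjoint_pow_mul_apply [CompleteSpace V] (Z : V →L[ℝ] V) (m n : ℕ) (w : V) :
    ⟪w, (adjoint Z ^ m * Z ^ n) w⟫ = ⟪(Z ^ m) w, (Z ^ n) w⟫ := by
  rw [← star_eq_adjoint, ← star_pow, star_eq_adjoint, mul_apply_eq_comp, adjoint_inner_right]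

/-- The filter increases the squared norm of `w` by at least `2 ν ‖Z ^ k w‖ ^ 2`. -/
theorem norm_filter_sq_ge [CompleteSpace V] {Z : V →L[ℝ] V} (hZ : ∀ v : V, ⟪Z v, v⟫ = 0)
    {k : ℕ} (hk : 1 ≤ k) (μ ν : ℝ) (w : V) :
    ‖w‖ ^ 2 + 2 * ν * ‖(Z ^ k) w‖ ^ 2 ≤
      ‖((1 : V →L[ℝ] V) + μ • (adjoint Z ^ (k - 1) * Z ^ k)
          + ν • (adjoint Z ^ k * Z ^ k)) w‖ ^ 2 := by
  have hμ : ⟪w, (adjoint Z ^ (k - 1) * Z ^ k) w⟫ = 0 := by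
    obtain ⟨m, rfl⟩ := Nat.exists_eq_add_of_le' hk
    rw [inner_adjoint_pow_mul_apply, Nat.add_sub_cancel, pow_succ', real_inner_comm]
    exact hZ _
  have hν : ⟪w, (adjoint Z ^ k * Z ^ k) w⟫ = ‖(Z ^ k) w‖ ^ 2 := by
    rw [inner_adjoint_pow_mul_apply, real_inner_self_eq_norm_sq]
  rw [add_apply, add_apply, one_apply_eq_self, smul_apply, smul_apply, add_assoc,
    norm_add_sq_real, inner_add_right, real_inner_smul_right, real_inner_smul_right, hμ, hν]
  nlinarith [sq_nonneg ‖μ • (adjoint Z ^ (k - 1) * Z ^ k) w + ν • (adjoint Z ^ k * Z ^ k) w‖]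

end Conservative

/-- the filtering method is NOT strongly stable when `ν > −β_{k*}/2`:
for energy conservative `Z` with small norm, the filtered solution has strictly larger
norm whenever `Z^{k*} u0 ≠ 0`. -/
theorem filtering_not_strongly_stable
    {V : Type*} [NormedAddCommGroup V] [InnerProductSpace ℝ V] [CompleteSpace V]
    (s : ℕ) (hs : 1 ≤ s) (α : ℕ → ℝ) (hα0 : α 0 = 1) (hα1 : α 1 = 1)
    (kst : ℕ) (hk1 : 1 ≤ kst) (hks : kst ≤ s)
    (β : ℕ → ℝ) (γ : ℕ → ℕ → ℝ) (hsym : ∀ i j, γ i j = γ j i)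
    (hidentity : ∀ Z : V →L[ℝ] V, (∀ v : V, ⟪Z v, v⟫ ≤ 0) → ∀ u0 : V,
      ‖(∑ j ∈ Finset.range (s + 1), α j • Z ^ j) u0‖ ^ 2 - ‖u0‖ ^ 2
        = ∑ k ∈ Finset.Icc kst s, β k * ‖(Z ^ k) u0‖ ^ 2
          + ∑ i ∈ Finset.range s, ∑ j ∈ Finset.range s,
              γ i j * semiIP Z ((Z ^ i) u0) ((Z ^ j) u0))
    (μ ν : ℝ) (hν : -β kst / 2 < ν) (hμ : kst = 1 → μ = 0) :
    ∃ lam0 : ℝ, 0 < lam0 ∧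
      ∀ Z : V →L[ℝ] V, (∀ v : V, ⟪Z v, v⟫ = 0) → ‖Z‖ ≤ lam0 → ∀ u0 : V,
        (Z ^ kst) u0 ≠ 0 →
        ‖((1 : V →L[ℝ] V) + μ • (adjoint Z ^ (kst - 1) * Z ^ kst)
            + ν • (adjoint Z ^ kst * Z ^ kst))
            ((∑ j ∈ Finset.range (s + 1), α j • Z ^ j) u0)‖ > ‖u0‖ := by
  set δ : ℝ := β kst + 2 * ν with hδ_def
  have hδ : 0 < δ := by linarith
  set B : ℝ := ∑ j ∈ Finset.Icc kst s, |β j|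
  have hB : 0 ≤ B := Finset.sum_nonneg fun _ _ => abs_nonneg _
  set C : ℝ := (1 + 2 * |ν|) * B with hC_def
  have hC : 0 ≤ C := by positivity
  have hCδ : 0 < C + δ := by linarith
  refine ⟨δ / (C + δ), by positivity, fun Z hZ hnorm u0 hu => ?_⟩
  set c : ℝ := δ / (C + δ) with hc_def
  have hc1 : c ≤ 1 := (div_le_one hCδ).2 (by linarith)
  have hc0 : 0 < c := by positivity
  have hcC : C * c < δ := by
    rw [hc_def, mul_div_assoc', div_lt_iff₀ hCδ]
    nlinarith
  set R : V →L[ℝ] V := ∑ j ∈ Finset.range (s + 1), α j • Z ^ j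
  have hR (u : V) : ‖R u‖ ^ 2 = ‖u‖ ^ 2 + ∑ k ∈ Finset.Icc kst s, β k * ‖(Z ^ k) u‖ ^ 2 := by
    have h := hidentity Z (fun v => (hZ v).le) u
    simp only [semiIP_eq_zero_of_conservative hZ, mul_zero, Finset.sum_const_zero, add_zero] at h
    linarith
  have hcomm : (Z ^ kst) (R u0) = R ((Z ^ kst) u0) := by
    have h : Commute (Z ^ kst) R := Commute.sum_right _ _ _ fun j _ =>
      ((Commute.refl Z).pow_pow kst j).smul_right (α j)
    exact congrArg (fun T : V →L[ℝ] V => T u0) h.eq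
  set y : V := (Z ^ kst) u0 with hy_def
  have hy : 0 < ‖y‖ ^ 2 := by positivity
  have hfilter := norm_filter_sq_ge hZ hk1 μ ν (R u0)
  rw [hcomm, hR y, hR u0] at hfilter
  have hsplit : ∑ k ∈ Finset.Icc kst s, β k * ‖(Z ^ k) u0‖ ^ 2
      = β kst * ‖y‖ ^ 2 + ∑ k ∈ Finset.Ioc kst s, β k * ‖(Z ^ (k - kst)) y‖ ^ 2 := by
    rw [← Finset.add_sum_Ioc_eq_sum_Icc hks]
    congr 1
    refine Finset.sum_congr rfl fun k hk => ?_
    rw [hy_def, ← mul_apply_eq_comp, ← pow_add, Nat.sub_add_cancel (Finset.mem_Ioc.1 hk).1.le]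
  have hhigher := abs_sum_mul_norm_pow_apply_sq_le hnorm hc1 (Finset.Ioc kst s) β (· - kst)
    (fun j hj => Nat.sub_pos_of_lt (Finset.mem_Ioc.1 hj).1) y
  have hfiltered := abs_sum_mul_norm_pow_apply_sq_le hnorm hc1 (Finset.Icc kst s) β id
    (fun j hj => hk1.trans (Finset.mem_Icc.1 hj).1) y
  simp only [id_eq] at hfiltered
  have hIoc : ∑ j ∈ Finset.Ioc kst s, |β j| ≤ B :=
    Finset.sum_le_sum_of_subset_of_nonneg Finset.Ioc_subset_Icc_self fun _ _ _ => abs_nonneg _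
  set S₁ := ∑ k ∈ Finset.Ioc kst s, β k * ‖(Z ^ (k - kst)) y‖ ^ 2
  set S₂ := ∑ k ∈ Finset.Icc kst s, β k * ‖(Z ^ k) y‖ ^ 2
  have h₁ : -(B * (c * ‖y‖ ^ 2)) ≤ S₁ :=
    neg_le_of_abs_le (hhigher.trans (mul_le_mul_of_nonneg_right hIoc (by positivity)))
  have h₂ : -(|ν| * (B * (c * ‖y‖ ^ 2))) ≤ ν * S₂ := by
    refine neg_le_of_abs_le ?_
    rw [abs_mul]
    exact mul_le_mul_of_nonneg_left hfiltered (abs_nonneg ν)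
  have hpos : C * c * ‖y‖ ^ 2 < δ * ‖y‖ ^ 2 := mul_lt_mul_of_pos_right hcC hy
  refine lt_of_pow_lt_pow_left₀ 2 (norm_nonneg _) (lt_of_lt_of_le ?_ hfilter)
  rw [hsplit]
  rw [hC_def, hδ_def] at hpos
  linarith
end

section
/- Let V be a real Hilbert space, D : V → V a continuous linear operator with adjoint D†, and u₀, u₊ ∈ V with D u₊ ≠ 0. Define the adaptive superviscosity coefficient ν := min( (‖u₀‖² − ‖u₊‖²) / ‖D u₊‖², 0 ) and the filtered solution u_F := u₊ + ν (D† (D u₊)). If |ν| ‖D‖² ≤ 1, then ‖u_F‖ ≤ ‖u₀‖. -/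
open RealInnerProductSpace ContinuousLinearMap

/-- the adaptive filtering step with
`ν := min((‖u₀‖² − ‖u₊‖²)/‖Du₊‖², 0)` and `u_F := u₊ + ν D†(D u₊)` satisfies
`‖u_F‖ ≤ ‖u₀‖` provided `|ν| ‖D‖² ≤ 1`. -/
theorem adaptive_filter_norm_le
    {V : Type*} [NormedAddCommGroup V] [InnerProductSpace ℝ V] [CompleteSpace V]
    (D : V →L[ℝ] V) (u₀ uplus : V) (hD : D uplus ≠ 0)
    (ν : ℝ) (hν : ν = min ((‖u₀‖ ^ 2 - ‖uplus‖ ^ 2) / ‖D uplus‖ ^ 2) 0)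
    (hsmall : |ν| * ‖D‖ ^ 2 ≤ 1) :
    ‖uplus + ν • (adjoint D (D uplus))‖ ≤ ‖u₀‖ := by
  have hν_nonpos : ν ≤ 0 := hν ▸ min_le_right _ _
  have hν_mul : ν * ‖D uplus‖ ^ 2 ≤ ‖u₀‖ ^ 2 - ‖uplus‖ ^ 2 := by
    rw [← le_div_iff₀ (by positivity)]
    exact hν ▸ min_le_left _ _
  have hadj : ‖adjoint D (D uplus)‖ ^ 2 ≤ ‖D‖ ^ 2 * ‖D uplus‖ ^ 2 := by
    have h := (adjoint D).le_opNorm (D uplus)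
    rw [LinearIsometryEquiv.norm_map] at h
    rw [← mul_pow]
    gcongr
  have hquad : ν ^ 2 * ‖adjoint D (D uplus)‖ ^ 2 ≤ -ν * ‖D uplus‖ ^ 2 := by
    rw [abs_of_nonpos hν_nonpos] at hsmall
    calc ν ^ 2 * ‖adjoint D (D uplus)‖ ^ 2
        ≤ ν ^ 2 * (‖D‖ ^ 2 * ‖D uplus‖ ^ 2) := by gcongr
      _ = (-ν * ‖D‖ ^ 2) * (-ν * ‖D uplus‖ ^ 2) := by ring
      _ ≤ 1 * (-ν * ‖D uplus‖ ^ 2) :=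
        mul_le_mul_of_nonneg_right hsmall
          (mul_nonneg (neg_nonneg.mpr hν_nonpos) (sq_nonneg _))
      _ = -ν * ‖D uplus‖ ^ 2 := one_mul _
  refine le_of_pow_le_pow_left₀ two_ne_zero (norm_nonneg _) ?_
  rw [norm_add_sq_real, inner_smul_right, adjoint_inner_right, real_inner_self_eq_norm_sq,
    norm_smul, mul_pow, Real.norm_eq_abs, sq_abs]
  linarith
end
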